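/- arXiv:2601.09339 — 2 statements merged into one kernel-verified Lean document; each statement's English description precedes it below -/
import Mathlib

section
/- Let X and Y be nonempty finite sets, and let (x_k)_{k≥1} and (y_k)_{k≥1} be sequences in X and Y respectively, with W_n defined by W_0 = 1 and W_n = W_{n−1} · P̂_n(x_n, y_n) / (Q̂_n(x_n) · R̂_n(y_n)). Then there is a constant C > 0 (depending only on |X| and |Y|) such that for all n ≥ 2, | (1/n)·log W_n − D(P̂_n ‖ Q̂_n ⊗ R̂_n) | ≤ C · (log n)/n, where D(P̂_n ‖ Q̂_n ⊗ R̂_n) := ∑_{(x,y)} P̂_n(x,y) · log( P̂_n(x,y) / (Q̂_n(x)·R̂_n(y)) ) is the Kullback–Leibler divergence on X × Y, with the convention 0·log 0 = 0. -/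
variable {X Y : Type*} [DecidableEq X] [DecidableEq Y]

/-- Joint count `T_n(x,y) = #{k ≤ n : x_k = x, y_k = y}`. -/
def Tjoint (x : ℕ → X) (y : ℕ → Y) (n : ℕ) (a : X) (b : Y) : ℕ :=
  ((Finset.Icc 1 n).filter fun k => x k = a ∧ y k = b).card

/-- Marginal count `T_n(x) = #{k ≤ n : x_k = x}`. -/
def Tfst (x : ℕ → X) (n : ℕ) (a : X) : ℕ :=
  ((Finset.Icc 1 n).filter fun k => x k = a).card

/-- Marginal count `T_n(y) = #{k ≤ n : y_k = y}`. -/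
def Tsnd (y : ℕ → Y) (n : ℕ) (b : Y) : ℕ :=
  ((Finset.Icc 1 n).filter fun k => y k = b).card

/-- The Kullback–Leibler divergence `D(P̂ₙ ‖ Q̂ₙ ⊗ R̂ₙ)` on `X × Y` of the empirical
joint distribution from the product of its marginals, with the convention
`0·log 0 = 0`. -/
noncomputable def empKL [Fintype X] [Fintype Y] (x : ℕ → X) (y : ℕ → Y) (n : ℕ) : ℝ :=
  ∑ a : X, ∑ b : Y,
    if Tjoint x y n a b = 0 then 0 else
      ((Tjoint x y n a b : ℝ) / n) *
        Real.log (((Tjoint x y n a b : ℝ) / n) /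
          (((Tfst x n a : ℝ) / n) * ((Tsnd y n b : ℝ) / n)))

/-- The error of the leading Stirling approximation `log m! ≈ m log m - m`. -/
noncomputable def stirlingError (m : ℕ) : ℝ :=
  Real.log (m.factorial : ℝ) - (m * Real.log m - m)

theorem log_factorial_succ (m : ℕ) :
    Real.log ((m + 1).factorial : ℝ) = Real.log (m.factorial : ℝ) + Real.log ((m + 1 : ℕ) : ℝ) := by
  rw [Nat.factorial_succ, Nat.cast_mul, Real.log_mul (by positivity) (by positivity), add_comm]

theorem stirlingError_bounds {m : ℕ} (hm : 1 ≤ m) :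
    0 ≤ stirlingError m ∧ stirlingError m ≤ 1 + Real.log m := by
  induction m, hm using Nat.le_induction with
  | base => simp [stirlingError]
  | succ m hm ih =>
    have hm0 : (0 : ℝ) < m := by exact_mod_cast hm
    have hlog : Real.log ((m + 1 : ℝ) / m) = Real.log (m + 1) - Real.log m :=
      Real.log_div (by positivity) (by positivity)
    have hupper := Real.log_le_sub_one_of_pos (x := (m + 1 : ℝ) / m) (by positivity)
    have hlower := Real.one_sub_inv_le_log_of_pos (x := (m + 1 : ℝ) / m) (by positivity)
    have h₁ : m * (Real.log (m + 1) - Real.log m) ≤ 1 := by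
      rw [← hlog]
      calc (m : ℝ) * Real.log ((m + 1) / m) ≤ m * ((m + 1) / m - 1) := by gcongr
        _ = 1 := by field_simp; ring
    have h₂ : 1 ≤ (m + 1) * (Real.log (m + 1) - Real.log m) := by
      rw [← hlog]
      calc (1 : ℝ) = (m + 1) * (1 - ((m + 1 : ℝ) / m)⁻¹) := by field_simp; ring
        _ ≤ _ := by gcongr
    unfold stirlingError at ih ⊢
    rw [log_factorial_succ]
    push_cast
    constructor <;> linarith [ih.1, ih.2]

theorem abs_stirlingError_le {m n : ℕ} (hmn : m ≤ n) (hn : 2 ≤ n) :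
    |stirlingError m| ≤ 3 * Real.log n := by
  have hlog : 1 / 2 ≤ Real.log n :=
    calc (1 / 2 : ℝ) ≤ Real.log 2 := by linarith [Real.log_two_gt_d9]
      _ ≤ Real.log n := Real.log_le_log (by norm_num) (by exact_mod_cast hn)
  rcases Nat.eq_zero_or_pos m with rfl | hm
  · have h : stirlingError 0 = 0 := by simp [stirlingError]
    rw [h, abs_zero]
    linarith
  · obtain ⟨h₀, h₁⟩ := stirlingError_bounds hm
    have : Real.log m ≤ Real.log n :=
      Real.log_le_log (by exact_mod_cast hm) (by exact_mod_cast hmn)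
    rw [abs_of_nonneg h₀]
    linarith

theorem Tfst_le (x : ℕ → X) (n : ℕ) (a : X) : Tfst x n a ≤ n :=
  (Finset.card_filter_le _ _).trans (by simp)

theorem Tfst_succ (x : ℕ → X) (n : ℕ) (a : X) :
    Tfst x (n + 1) a = Tfst x n a + if x (n + 1) = a then 1 else 0 := by
  simp only [Tfst, Finset.card_filter]
  rw [Finset.sum_Icc_succ_top (by omega)]

theorem Tfst_self_pos (x : ℕ → X) (n : ℕ) : 0 < Tfst x (n + 1) (x (n + 1)) := by
  simp [Tfst_succ]

theorem Tjoint_eq_Tfst (x : ℕ → X) (y : ℕ → Y) (n : ℕ) (a : X) (b : Y) :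
    Tjoint x y n a b = Tfst (fun k => (x k, y k)) n (a, b) := by
  simp [Tjoint, Tfst]

theorem Tsnd_eq_Tfst (y : ℕ → Y) (n : ℕ) (b : Y) : Tsnd y n b = Tfst y n b := rfl

theorem sum_Tfst [Fintype X] (x : ℕ → X) (n : ℕ) : ∑ a, Tfst x n a = n := by
  simpa [Tfst] using (Finset.card_eq_sum_card_fiberwise (f := x) (s := Finset.Icc 1 n)
    (t := Finset.univ) (by simp)).symm

theorem sum_snd_Tjoint [Fintype Y] (x : ℕ → X) (y : ℕ → Y) (n : ℕ) (a : X) :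
    ∑ b, Tjoint x y n a b = Tfst x n a := by
  simpa [Tjoint, Tfst, Finset.filter_filter] using
    (Finset.card_eq_sum_card_fiberwise (f := y)
      (s := (Finset.Icc 1 n).filter fun k => x k = a) (t := Finset.univ) (by simp)).symm

theorem sum_fst_Tjoint [Fintype X] (x : ℕ → X) (y : ℕ → Y) (n : ℕ) (b : Y) :
    ∑ a, Tjoint x y n a b = Tsnd y n b := by
  rw [Tsnd_eq_Tfst, ← sum_snd_Tjoint y x n b]
  simp only [Tjoint, and_comm]

theorem Tjoint_le_Tfst (x : ℕ → X) (y : ℕ → Y) (n : ℕ) (a : X) (b : Y) :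
    Tjoint x y n a b ≤ Tfst x n a :=
  Finset.card_le_card (Finset.monotone_filter_right _ fun _ _ h => h.1)

theorem Tjoint_le_Tsnd (x : ℕ → X) (y : ℕ → Y) (n : ℕ) (a : X) (b : Y) :
    Tjoint x y n a b ≤ Tsnd y n b :=
  Finset.card_le_card (Finset.monotone_filter_right _ fun _ _ h => h.2)

theorem sum_log_factorial_Tfst_succ [Fintype X] (x : ℕ → X) (n : ℕ) :
    ∑ a, Real.log ((Tfst x (n + 1) a).factorial : ℝ) =
      ∑ a, Real.log ((Tfst x n a).factorial : ℝ) +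
        Real.log (Tfst x (n + 1) (x (n + 1)) : ℝ) := by
  have h (a : X) : Real.log ((Tfst x (n + 1) a).factorial : ℝ) =
      Real.log ((Tfst x n a).factorial : ℝ) +
        if x (n + 1) = a then Real.log (Tfst x (n + 1) a : ℝ) else 0 := by
    rw [Tfst_succ]
    split_ifs
    · exact log_factorial_succ _
    · simp
  simp only [h, Finset.sum_add_distrib, Finset.sum_ite_eq, Finset.mem_univ, if_true]

theorem capital_pos_and_log_eq [Fintype X] [Fintype Y] (x : ℕ → X) (y : ℕ → Y) (W : ℕ → ℝ)
    (hW₀ : W 0 = 1)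
    (hW : ∀ n, 1 ≤ n → W n = W (n - 1) *
      ((Tjoint x y n (x n) (y n) : ℝ) / n) /
      (((Tfst x n (x n) : ℝ) / n) * ((Tsnd y n (y n) : ℝ) / n))) (n : ℕ) :
    0 < W n ∧ Real.log (W n) =
      Real.log (n.factorial : ℝ)
        + ∑ p : X × Y, Real.log ((Tfst (fun k => (x k, y k)) n p).factorial : ℝ)
        - ∑ a, Real.log ((Tfst x n a).factorial : ℝ)
        - ∑ b, Real.log ((Tfst y n b).factorial : ℝ) := by
  induction n with
  | zero => simp [hW₀, Tfst]
  | succ n ih =>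
    obtain ⟨hpos, hlog⟩ := ih
    have hz : (0 : ℝ) < Tfst (fun k => (x k, y k)) (n + 1) (x (n + 1), y (n + 1)) := by
      exact_mod_cast Tfst_self_pos (fun k => (x k, y k)) n
    have hx : (0 : ℝ) < Tfst x (n + 1) (x (n + 1)) := by exact_mod_cast Tfst_self_pos x n
    have hy : (0 : ℝ) < Tfst y (n + 1) (y (n + 1)) := by exact_mod_cast Tfst_self_pos y n
    have hn : (0 : ℝ) < (n + 1 : ℕ) := by positivity
    have hstep := hW (n + 1) (by omega)
    rw [Nat.add_sub_cancel, Tjoint_eq_Tfst, Tsnd_eq_Tfst] at hstep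
    rw [sum_log_factorial_Tfst_succ, sum_log_factorial_Tfst_succ, sum_log_factorial_Tfst_succ,
      log_factorial_succ, hstep]
    refine ⟨by positivity, ?_⟩
    rw [Real.log_div (by positivity) (by positivity), Real.log_mul (by positivity) (by positivity),
      Real.log_mul (by positivity) (by positivity), Real.log_div (by positivity) (by positivity),
      Real.log_div (by positivity) (by positivity), Real.log_div (by positivity) (by positivity),
      hlog]
    ring

theorem natCast_mul_empKL [Fintype X] [Fintype Y] (x : ℕ → X) (y : ℕ → Y) {n : ℕ} (hn : 0 < n) :
    n * empKL x y n =
      n * Real.log n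
        + ∑ p : X × Y, (Tfst (fun k => (x k, y k)) n p : ℝ) *
            Real.log (Tfst (fun k => (x k, y k)) n p)
        - ∑ a, (Tfst x n a : ℝ) * Real.log (Tfst x n a)
        - ∑ b, (Tfst y n b : ℝ) * Real.log (Tfst y n b) := by
  have hn0 : (0 : ℝ) < n := by exact_mod_cast hn
  have hterm (a : X) (b : Y) :
      (n : ℝ) * (if Tjoint x y n a b = 0 then 0 else
        ((Tjoint x y n a b : ℝ) / n) *
          Real.log (((Tjoint x y n a b : ℝ) / n) /
            (((Tfst x n a : ℝ) / n) * ((Tsnd y n b : ℝ) / n)))) =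
      Tjoint x y n a b * Real.log n + Tjoint x y n a b * Real.log (Tjoint x y n a b)
        - Tjoint x y n a b * Real.log (Tfst x n a)
        - Tjoint x y n a b * Real.log (Tsnd y n b) := by
    split_ifs with h
    · simp [h]
    · have hz : 0 < Tjoint x y n a b := Nat.pos_of_ne_zero h
      have hz0 : (0 : ℝ) < Tjoint x y n a b := by exact_mod_cast hz
      have hx0 : (0 : ℝ) < Tfst x n a := by
        exact_mod_cast hz.trans_le (Tjoint_le_Tfst x y n a b)
      have hy0 : (0 : ℝ) < Tsnd y n b := by
        exact_mod_cast hz.trans_le (Tjoint_le_Tsnd x y n a b)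
      rw [Real.log_div (by positivity) (by positivity),
        Real.log_mul (by positivity) (by positivity), Real.log_div (by positivity) (by positivity),
        Real.log_div (by positivity) (by positivity), Real.log_div (by positivity) (by positivity)]
      field_simp
      ring
  have hsum_n : ∑ a, ∑ b, (Tjoint x y n a b : ℝ) * Real.log n = n * Real.log n := by
    simp_rw [← Finset.sum_mul, ← Nat.cast_sum, sum_snd_Tjoint, sum_Tfst]
  have hsum_x : ∑ a, ∑ b, (Tjoint x y n a b : ℝ) * Real.log (Tfst x n a) =
      ∑ a, (Tfst x n a : ℝ) * Real.log (Tfst x n a) := by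
    simp_rw [← Finset.sum_mul, ← Nat.cast_sum, sum_snd_Tjoint]
  have hsum_y : ∑ a, ∑ b, (Tjoint x y n a b : ℝ) * Real.log (Tsnd y n b) =
      ∑ b, (Tfst y n b : ℝ) * Real.log (Tfst y n b) := by
    rw [Finset.sum_comm]
    simp_rw [← Finset.sum_mul, ← Nat.cast_sum, sum_fst_Tjoint, Tsnd_eq_Tfst]
  simp_rw [empKL, Finset.mul_sum, hterm, Finset.sum_sub_distrib, Finset.sum_add_distrib]
  rw [hsum_n, hsum_x, hsum_y, Fintype.sum_prod_type]
  simp_rw [Tjoint_eq_Tfst]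

theorem sum_stirlingError_Tfst [Fintype X] (x : ℕ → X) (n : ℕ) :
    ∑ a, stirlingError (Tfst x n a) =
      ∑ a, Real.log ((Tfst x n a).factorial : ℝ)
        - (∑ a, (Tfst x n a : ℝ) * Real.log (Tfst x n a) - n) := by
  simp_rw [stirlingError, Finset.sum_sub_distrib, ← Nat.cast_sum, sum_Tfst]

theorem abs_sum_stirlingError_Tfst_le [Fintype X] (x : ℕ → X) {n : ℕ} (hn : 2 ≤ n) :
    |∑ a, stirlingError (Tfst x n a)| ≤ Fintype.card X * (3 * Real.log n) := by
  refine (Finset.abs_sum_le_sum_abs _ _).trans ?_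
  refine (Finset.sum_le_card_nsmul _ _ _ fun a _ =>
    abs_stirlingError_le (Tfst_le x n a) hn).trans ?_
  simp

/-- **Stirling estimate for the independence-testing capital process.**
There is a constant `C > 0`, depending only on the (finite, nonempty) alphabets
`X` and `Y`, such that for all sequences, all `W` satisfying the recursion
`W₀ = 1`, `Wₙ = Wₙ₋₁ · P̂ₙ(xₙ,yₙ)/(Q̂ₙ(xₙ)·R̂ₙ(yₙ))`, and all `n ≥ 2`,
`|(1/n)·log Wₙ − D(P̂ₙ ‖ Q̂ₙ ⊗ R̂ₙ)| ≤ C·(log n)/n`. -/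
theorem capital_process_KL_estimate [Fintype X] [Fintype Y] [Nonempty X] [Nonempty Y] :
    ∃ C : ℝ, 0 < C ∧
      ∀ (x : ℕ → X) (y : ℕ → Y) (W : ℕ → ℝ), W 0 = 1 →
        (∀ n, 1 ≤ n → W n = W (n - 1) *
            ((Tjoint x y n (x n) (y n) : ℝ) / n) /
            (((Tfst x n (x n) : ℝ) / n) * ((Tsnd y n (y n) : ℝ) / n))) →
        ∀ n : ℕ, 2 ≤ n →
          |(1 / (n : ℝ)) * Real.log (W n) - empKL x y n| ≤ C * Real.log n / n := by
  refine ⟨3 * (1 + Fintype.card (X × Y) + Fintype.card X + Fintype.card Y), by positivity, ?_⟩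
  intro x y W hW₀ hW n hn
  have hn0 : (0 : ℝ) < n := by exact_mod_cast (by omega : 0 < n)
  have hlog := (capital_pos_and_log_eq x y W hW₀ hW n).2
  have hKL := natCast_mul_empKL x y (by omega : 0 < n)
  have herr : Real.log (W n) - n * empKL x y n =
      stirlingError n + ∑ p, stirlingError (Tfst (fun k => (x k, y k)) n p)
        - ∑ a, stirlingError (Tfst x n a) - ∑ b, stirlingError (Tfst y n b) := by
    rw [sum_stirlingError_Tfst, sum_stirlingError_Tfst, sum_stirlingError_Tfst, hlog, hKL,
      stirlingError]
    ring
  have hscale : (1 / (n : ℝ)) * Real.log (W n) - empKL x y n =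
      (Real.log (W n) - n * empKL x y n) / n := by
    field_simp
  rw [hscale, abs_div, abs_of_pos hn0, herr]
  gcongr
  have h₁ := abs_le.mp (abs_stirlingError_le le_rfl hn)
  have h₂ := abs_le.mp (abs_sum_stirlingError_Tfst_le (fun k => (x k, y k)) hn)
  have h₃ := abs_le.mp (abs_sum_stirlingError_Tfst_le x hn)
  have h₄ := abs_le.mp (abs_sum_stirlingError_Tfst_le y hn)
  rw [abs_le]
  constructor <;> linarith [h₁.1, h₁.2, h₂.1, h₂.2, h₃.1, h₃.2, h₄.1, h₄.2]
end

section
/- Let (τ_k)_{k≥1} be a sequence in Ω⁴ and (u_k)_{k≥1} = ((s_k,t_k))_{k≥1} a sequence in Θ. Assume liminf_{n→∞} R̂_n(u) > 0 for every u ∈ Θ, and that for every τ ∈ Ω⁴ and u ∈ Θ, P̂_n(τ;u) − Q̂_n(τ)·R̂_n(u) → 0 as n → ∞. Define the empirical correlations C_n(s,t) := ∑_{(a,b)∈Ω²} a·b · S_n(a,b;s,t)/T_n((s,t)), where S_n(a,b;s,t) := #{k ≤ n : τ_k^s = a, τ_k^t = b, u_k = (s,t)}. Then limsup_{n→∞}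 | C_n(1,3) − C_n(1,4) + C_n(2,3) + C_n(2,4) | ≤ 2. -/
open Filter

/-- The two-point set `{+1, -1}` of measurement outcomes. -/
abbrev Sign := ({1, -1} : Finset ℤ)

/-- The four preassigned outcomes: an element of `Ω⁴`. -/
abbrev O4 := Sign × Sign × Sign × Sign

/-- The `s`-th coordinate of a quadruple `τ ∈ Ω⁴`, for `s ∈ {1,2,3,4}`. -/
def coord (τ : O4) : ℕ → ℤ
  | 1 => τ.1
  | 2 => τ.2.1
  | 3 => τ.2.2.1
  | 4 => τ.2.2.2
  | _ => 1

/-- The set of joint measurement settings `Θ = {1,2} × {3,4}`. -/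
def ThetaF : Finset (ℕ × ℕ) := ({1, 2} : Finset ℕ) ×ˢ ({3, 4} : Finset ℕ)

/-- Joint count `T_n(τ; u) = #{k ≤ n : τ_k = τ, u_k = u}`. -/
def Tj (τ : ℕ → O4) (u : ℕ → ℕ × ℕ) (n : ℕ) (a : O4) (v : ℕ × ℕ) : ℕ :=
  ((Finset.Icc 1 n).filter fun k => τ k = a ∧ u k = v).card

/-- Marginal count `T_n(τ) = #{k ≤ n : τ_k = τ}`. -/
def Tt (τ : ℕ → O4) (n : ℕ) (a : O4) : ℕ :=
  ((Finset.Icc 1 n).filter fun k => τ k = a).card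

/-- Marginal count `T_n(u) = #{k ≤ n : u_k = u}`. -/
def Tu (u : ℕ → ℕ × ℕ) (n : ℕ) (v : ℕ × ℕ) : ℕ :=
  ((Finset.Icc 1 n).filter fun k => u k = v).card

/-- `S_n(a,b; s,t) = #{k ≤ n : τ_kˢ = a, τ_kᵗ = b, u_k = (s,t)}`. -/
def SpairSet (τ : ℕ → O4) (u : ℕ → ℕ × ℕ) (n : ℕ) (s t : ℕ) (a b : Sign) : ℕ :=
  ((Finset.Icc 1 n).filter fun k =>
    coord (τ k) s = (a : ℤ) ∧ coord (τ k) t = (b : ℤ) ∧ u k = (s, t)).card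

/-- The empirical correlation `C_n(s,t) = ∑_{(a,b)} a·b · S_n(a,b;s,t)/T_n((s,t))`. -/
noncomputable def empCorr (τ : ℕ → O4) (u : ℕ → ℕ × ℕ) (n : ℕ) (s t : ℕ) : ℝ :=
  ∑ a : Sign, ∑ b : Sign,
    ((a : ℤ) : ℝ) * ((b : ℤ) : ℝ) * ((SpairSet τ u n s t a b : ℝ) / (Tu u n (s, t) : ℝ))

/-- Weighting the sizes of the fibres of `g` over `A` amounts to summing over `A`. -/
theorem sum_mul_card_fiber {ι κ : Type*} [Fintype ι] [DecidableEq ι] (A : Finset κ)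
    (g : κ → ι) (F : ι → ℝ) :
    ∑ j, F j * ((A.filter fun k => g k = j).card : ℝ) = ∑ k ∈ A, F (g k) := by
  rw [← Finset.sum_fiberwise A g fun k => F (g k)]
  refine Finset.sum_congr rfl fun j _ => ?_
  rw [Finset.sum_congr rfl (g := fun _ => F j) fun k hk => by rw [(Finset.mem_filter.1 hk).2],
    Finset.sum_const, nsmul_eq_mul, mul_comm]

theorem coord_mem_sign (a : O4) (s : ℕ) : coord a s ∈ ({1, -1} : Finset ℤ) := by
  unfold coord
  split <;> first | exact Subtype.property _ | simp

theorem sum_coord_mul_SpairSet (τ : ℕ → O4) (u : ℕ → ℕ × ℕ) (n s t : ℕ) :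
    ∑ a : Sign, ∑ b : Sign, ((a : ℤ) : ℝ) * ((b : ℤ) : ℝ) * (SpairSet τ u n s t a b : ℝ)
      = ∑ a : O4, (coord a s : ℝ) * (coord a t : ℝ) * (Tj τ u n a (s, t) : ℝ) := by
  have hpair := sum_mul_card_fiber ((Finset.Icc 1 n).filter fun k => u k = (s, t))
    (fun k => ((⟨coord (τ k) s, coord_mem_sign _ _⟩, ⟨coord (τ k) t, coord_mem_sign _ _⟩) :
      Sign × Sign)) (fun p => ((p.1 : ℤ) : ℝ) * ((p.2 : ℤ) : ℝ))
  have hquad := sum_mul_card_fiber ((Finset.Icc 1 n).filter fun k => u k = (s, t)) τ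
    (fun a => (coord a s : ℝ) * (coord a t : ℝ))
  rw [Fintype.sum_prod_type] at hpair
  refine Eq.trans ?_ (hpair.trans (hquad.symm.trans ?_))
  · refine Finset.sum_congr rfl fun a _ => Finset.sum_congr rfl fun b _ => ?_
    rw [SpairSet, Finset.filter_filter]
    congr 3
    ext k
    simp only [Finset.mem_filter, Prod.mk.injEq, Subtype.ext_iff]
    tauto
  · refine Finset.sum_congr rfl fun a _ => ?_
    rw [Tj, Finset.filter_filter]
    simp only [and_comm]

/-- The empirical correlation is the conditional average of the product of coordinates. -/
theorem empCorr_eq_sum_Tj (τ : ℕ → O4) (u : ℕ → ℕ × ℕ) (n s t : ℕ) :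
    empCorr τ u n s t = ∑ a : O4, (coord a s : ℝ) * (coord a t : ℝ) *
      ((Tj τ u n a (s, t) : ℝ) / (Tu u n (s, t) : ℝ)) := by
  simp only [empCorr, ← mul_div_assoc, ← Finset.sum_div, sum_coord_mul_SpairSet]

theorem sum_Tt_div_le_one (τ : ℕ → O4) (n : ℕ) : ∑ a : O4, (Tt τ n a : ℝ) / n ≤ 1 := by
  have h := sum_mul_card_fiber (Finset.Icc 1 n) τ fun _ => 1
  simp only [one_mul, Finset.sum_const, Nat.card_Icc, add_tsub_cancel_right, nsmul_eq_mul,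
    mul_one] at h
  rw [← Finset.sum_div]
  simp only [Tt, h]
  exact div_self_le_one _

/-- The correlation of two coordinates under the empirical distribution of the quadruples. -/
noncomputable def marginalCorr (τ : ℕ → O4) (n s t : ℕ) : ℝ :=
  ∑ a : O4, (coord a s : ℝ) * (coord a t : ℝ) * ((Tt τ n a : ℝ) / n)

theorem abs_coord_chsh_le_two (a : O4) :
    |(coord a 1 : ℝ) * coord a 3 - coord a 1 * coord a 4 + coord a 2 * coord a 3
      + coord a 2 * coord a 4| ≤ 2 := by
  have h : ∀ s, (coord a s : ℝ) = 1 ∨ (coord a s : ℝ) = -1 := fun s => by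
    have := coord_mem_sign a s
    simp only [Finset.mem_insert, Finset.mem_singleton] at this
    exact_mod_cast this
  rcases h 1 with h₁ | h₁ <;> rcases h 2 with h₂ | h₂ <;> rcases h 3 with h₃ | h₃ <;>
    rcases h 4 with h₄ | h₄ <;> rw [h₁, h₂, h₃, h₄] <;> norm_num

theorem abs_marginalCorr_chsh_le_two (τ : ℕ → O4) (n : ℕ) :
    |marginalCorr τ n 1 3 - marginalCorr τ n 1 4 + marginalCorr τ n 2 3
      + marginalCorr τ n 2 4| ≤ 2 := by
  simp only [marginalCorr, ← Finset.sum_sub_distrib, ← Finset.sum_add_distrib, ← sub_mul,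
    ← add_mul]
  calc _ ≤ ∑ a : O4, 2 * ((Tt τ n a : ℝ) / n) := by
        refine (Finset.abs_sum_le_sum_abs _ _).trans (Finset.sum_le_sum fun a _ => ?_)
        have hp : (0 : ℝ) ≤ (Tt τ n a : ℝ) / n := by positivity
        rw [abs_mul, abs_of_nonneg hp]
        exact mul_le_mul_of_nonneg_right (abs_coord_chsh_le_two a) hp
    _ ≤ 2 := by
        rw [← Finset.mul_sum]
        linarith [sum_Tt_div_le_one τ n]

/-- Dividing an asymptotic factorization by a factor of positive lower density. -/
theorem tendsto_conditional_sub_marginal (τ : ℕ → O4) (u : ℕ → ℕ × ℕ) (a : O4) (v : ℕ × ℕ)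
    (hliminf : 0 < liminf (fun n => (Tu u n v : ℝ) / n) atTop)
    (hindep : Tendsto (fun n => (Tj τ u n a v : ℝ) / n
      - ((Tt τ n a : ℝ) / n) * ((Tu u n v : ℝ) / n)) atTop (nhds 0)) :
    Tendsto (fun n => (Tj τ u n a v : ℝ) / (Tu u n v : ℝ) - (Tt τ n a : ℝ) / n)
      atTop (nhds 0) := by
  obtain ⟨c, hc, hlt⟩ := exists_between hliminf
  have hbdd : IsBoundedUnder (· ≥ ·) atTop fun n : ℕ => (Tu u n v : ℝ) / n :=
    isBoundedUnder_of ⟨0, fun n => by positivity⟩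
  have hlim := hindep.abs.div_const c
  rw [abs_zero, zero_div] at hlim
  refine squeeze_zero_norm' ?_ hlim
  filter_upwards [eventually_lt_of_lt_liminf hlt hbdd, eventually_gt_atTop 0] with n hn hpos
  have hn' : (n : ℝ) ≠ 0 := by positivity
  have hT : (Tu u n v : ℝ) ≠ 0 := by
    intro h0
    rw [h0, zero_div] at hn
    exact hn.not_gt hc
  have heq : (Tj τ u n a v : ℝ) / (Tu u n v : ℝ) - (Tt τ n a : ℝ) / n
      = ((Tj τ u n a v : ℝ) / n - ((Tt τ n a : ℝ) / n) * ((Tu u n v : ℝ) / n))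
        / ((Tu u n v : ℝ) / n) := by
    field_simp
  rw [heq, Real.norm_eq_abs, abs_div, abs_of_pos (hc.trans hn)]
  exact div_le_div_of_nonneg_left (abs_nonneg _) hc hn.le

theorem tendsto_empCorr_sub_marginalCorr (τ : ℕ → O4) (u : ℕ → ℕ × ℕ) (s t : ℕ)
    (hliminf : 0 < liminf (fun n => (Tu u n (s, t) : ℝ) / n) atTop)
    (hindep : ∀ a : O4, Tendsto (fun n => (Tj τ u n a (s, t) : ℝ) / n
      - ((Tt τ n a : ℝ) / n) * ((Tu u n (s, t) : ℝ) / n)) atTop (nhds 0)) :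
    Tendsto (fun n => empCorr τ u n s t - marginalCorr τ n s t) atTop (nhds 0) := by
  simp only [empCorr_eq_sum_Tj, marginalCorr, ← Finset.sum_sub_distrib, ← mul_sub]
  rw [← Finset.sum_const_zero (s := (Finset.univ : Finset O4))]
  refine tendsto_finsetSum _ fun a _ => ?_
  rw [← mul_zero ((coord a s : ℝ) * (coord a t : ℝ))]
  exact (tendsto_conditional_sub_marginal τ u a (s, t) hliminf (hindep a)).const_mul _

/-- **Asymptotic CHSH inequality under empirical measurement independence.**
If every setting pair has positive lower density and the empirical joint
distribution on `Ω⁴ × Θ` factorizes asymptotically, then the empirical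
correlations satisfy `limsup |C_n(1,3) − C_n(1,4) + C_n(2,3) + C_n(2,4)| ≤ 2`. -/
theorem asymptotic_chsh_of_empirical_independence
    (τ : ℕ → O4) (u : ℕ → ℕ × ℕ) (hu : ∀ k, u k ∈ ThetaF)
    (hliminf : ∀ v ∈ ThetaF, 0 < liminf (fun n => (Tu u n v : ℝ) / n) atTop)
    (hindep : ∀ a : O4, ∀ v ∈ ThetaF,
      Tendsto (fun n => (Tj τ u n a v : ℝ) / n - ((Tt τ n a : ℝ) / n) * ((Tu u n v : ℝ) / n))
        atTop (nhds 0)) :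
    limsup (fun n => |empCorr τ u n 1 3 - empCorr τ u n 1 4
        + empCorr τ u n 2 3 + empCorr τ u n 2 4|) atTop ≤ 2 := by
  have key : ∀ s t, (s, t) ∈ ThetaF →
      Tendsto (fun n => empCorr τ u n s t - marginalCorr τ n s t) atTop (nhds 0) :=
    fun s t h => tendsto_empCorr_sub_marginalCorr τ u s t (hliminf _ h) fun a => hindep a _ h
  have h₁₃ := key 1 3 (by simp [ThetaF])
  have h₁₄ := key 1 4 (by simp [ThetaF])
  have h₂₃ := key 2 3 (by simp [ThetaF])
  have h₂₄ := key 2 4 (by simp [ThetaF])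
  have hlim := (((h₁₃.sub h₁₄).add h₂₃).add h₂₄).abs.const_add 2
  simp only [sub_zero, add_zero, abs_zero] at hlim
  rw [← hlim.limsup_eq]
  refine limsup_le_limsup (Eventually.of_forall fun n => ?_)
    (isCoboundedUnder_le_of_le atTop fun n => abs_nonneg _) hlim.isBoundedUnder_le
  have htri := abs_add_le
    (marginalCorr τ n 1 3 - marginalCorr τ n 1 4 + marginalCorr τ n 2 3 + marginalCorr τ n 2 4)
    (empCorr τ u n 1 3 - marginalCorr τ n 1 3 - (empCorr τ u n 1 4 - marginalCorr τ n 1 4)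
      + (empCorr τ u n 2 3 - marginalCorr τ n 2 3) + (empCorr τ u n 2 4 - marginalCorr τ n 2 4))
  have hbound := abs_marginalCorr_chsh_le_two τ n
  ring_nf at htri hbound ⊢
  linarith
end
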